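/- arXiv:0903.2593 — 2 statements merged into one kernel-verified Lean document; each statement's English description precedes it below -/
import Mathlib

section
/- A compact Hausdorff space X is co-absolute with a compact metrizable space if and only if πw(X) ≤ ℵ₀. -/
universe u

/-- A π-base of a topological space: a family of open sets such that every nonempty open
set contains a nonempty member of the family. -/
def IsPiBase {X : Type*} [TopologicalSpace X] (B : Set (Set X)) : Prop :=
  (∀ U ∈ B, IsOpen U) ∧ ∀ V : Set X, IsOpen V → V ≠ ∅ → ∃ U ∈ B, U ≠ ∅ ∧ U ⊆ V

/-- The π-weight of a topological space: the minimum cardinality of a π-base. -/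
noncomputable def piWeight (X : Type*) [TopologicalSpace X] : Cardinal :=
  ⨅ B : {B : Set (Set X) // IsPiBase B}, Cardinal.mk ↥B.1

/-- `g` is a continuous irreducible map of `(E, tE)` onto `(Z, tZ)`:
continuous, surjective, and no proper closed subset maps onto `Z`. -/
def IrreducibleOnto {E Z : Type*} (tE : TopologicalSpace E) (tZ : TopologicalSpace Z)
    (g : E → Z) : Prop :=
  @Continuous E Z tE tZ g ∧ Function.Surjective g ∧
    ∀ A : Set E, @IsClosed E tE A → A ≠ Set.univ → g '' A ≠ Set.univ

/-- `X` and `Y` are co-absolute: there is an extremally disconnected compact Hausdorff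
space `E` and irreducible continuous maps from `E` onto `X` and onto `Y`. -/
def CoAbsolute (X Y : Type u) (tX : TopologicalSpace X) (tY : TopologicalSpace Y) : Prop :=
  ∃ (E : Type u) (tE : TopologicalSpace E),
    @CompactSpace E tE ∧ @T2Space E tE ∧ @ExtremallyDisconnected E tE ∧
    (∃ g : E → X, IrreducibleOnto tE tX g) ∧ ∃ h : E → Y, IrreducibleOnto tE tY h

open Set Function Topology

theorem piWeight_le_aleph0_iff {X : Type*} [TopologicalSpace X] :
    piWeight X ≤ Cardinal.aleph0 ↔ ∃ B : Set (Set X), IsPiBase B ∧ B.Countable := by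
  constructor
  · intro h
    have : Nonempty {B : Set (Set X) // IsPiBase B} :=
      ⟨⟨{U | IsOpen U}, fun _ hU => hU, fun V hV hne => ⟨V, hV, hne, Subset.rfl⟩⟩⟩
    obtain ⟨B, hB⟩ :=
      ciInf_mem (fun B : {B : Set (Set X) // IsPiBase B} => Cardinal.mk ↥B.1)
    refine ⟨B.1, B.2, ?_⟩
    rw [← Cardinal.le_aleph0_iff_set_countable]
    exact hB.le.trans h
  · rintro ⟨B, hB, hc⟩
    exact (ciInf_le' _ (⟨B, hB⟩ : {B : Set (Set X) // IsPiBase B})).trans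
      (Cardinal.le_aleph0_iff_set_countable.2 hc)

theorem TopologicalSpace.IsTopologicalBasis.isPiBase {X : Type*} [TopologicalSpace X]
    {B : Set (Set X)} (hB : TopologicalSpace.IsTopologicalBasis B) : IsPiBase B := by
  refine ⟨fun U hU => hB.isOpen hU, fun V hV hne => ?_⟩
  obtain ⟨x, hx⟩ := nonempty_iff_ne_empty.2 hne
  obtain ⟨U, hU, hxU, hUV⟩ := hB.exists_subset_of_mem_open hx hV
  exact ⟨U, hU, nonempty_iff_ne_empty.1 ⟨x, hxU⟩, hUV⟩

namespace IrreducibleOnto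

variable {E Z : Type*} [tE : TopologicalSpace E] [tZ : TopologicalSpace Z] {g : E → Z}

theorem image_compl_compl_nonempty (hg : IrreducibleOnto tE tZ g) {U : Set E} (hU : IsOpen U)
    (hne : U ≠ ∅) : ((g '' Uᶜ)ᶜ).Nonempty :=
  nonempty_compl.2 (hg.2.2 _ hU.isClosed_compl (by simpa using hne))

theorem isOpen_image_compl_compl [CompactSpace E] [T2Space Z] (hg : IrreducibleOnto tE tZ g)
    {U : Set E} (hU : IsOpen U) : IsOpen (g '' Uᶜ)ᶜ :=
  (hU.isClosed_compl.isCompact.image hg.1).isClosed.isOpen_compl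

theorem isPiBase_preimage [CompactSpace E] [T2Space Z] (hg : IrreducibleOnto tE tZ g)
    {B : Set (Set Z)} (hB : IsPiBase B) : IsPiBase ((g ⁻¹' ·) '' B) := by
  refine ⟨?_, fun V hV hne => ?_⟩
  · rintro _ ⟨U, hU, rfl⟩
    exact (hB.1 U hU).preimage hg.1
  · obtain ⟨U, hU, hUne, hUV⟩ := hB.2 _ (hg.isOpen_image_compl_compl hV)
      (nonempty_iff_ne_empty.1 (hg.image_compl_compl_nonempty hV hne))
    refine ⟨_, ⟨U, hU, rfl⟩, ?_, fun e he => ?_⟩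
    · exact nonempty_iff_ne_empty.1 ((nonempty_iff_ne_empty.2 hUne).preimage hg.2.1)
    · by_contra h
      exact hUV he ⟨e, h, rfl⟩

theorem isPiBase_image_compl_compl [CompactSpace E] [T2Space Z] (hg : IrreducibleOnto tE tZ g)
    {B : Set (Set E)} (hB : IsPiBase B) : IsPiBase ((fun U => (g '' Uᶜ)ᶜ) '' B) := by
  refine ⟨?_, fun V hV hne => ?_⟩
  · rintro _ ⟨U, hU, rfl⟩
    exact hg.isOpen_image_compl_compl (hB.1 U hU)
  · obtain ⟨U, hU, hUne, hUV⟩ := hB.2 _ (hV.preimage hg.1)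
      (nonempty_iff_ne_empty.1 ((nonempty_iff_ne_empty.2 hne).preimage hg.2.1))
    refine ⟨_, ⟨U, hU, rfl⟩, ?_, fun z hz => ?_⟩
    · exact nonempty_iff_ne_empty.1 (hg.image_compl_compl_nonempty (hB.1 U hU) hUne)
    · obtain ⟨e, rfl⟩ := hg.2.1 z
      by_contra h
      exact hz ⟨e, fun he => h (hUV he), rfl⟩

/-- The only continuous self-map over an irreducible map is the identity. -/
theorem eq_id_of_comp_eq [T2Space E] (hg : IrreducibleOnto tE tZ g) {f : E → E}
    (hf : Continuous f) (hgf : g ∘ f = g) : f = id := by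
  funext e
  by_contra hne
  obtain ⟨V, U, hV, hU, hfV, heU, hd⟩ := t2_separation hne
  have hW : IsOpen (U ∩ f ⁻¹' V) := hU.inter (hV.preimage hf)
  refine (nonempty_iff_ne_empty.1 <| hg.image_compl_compl_nonempty hW
    (nonempty_iff_ne_empty.1 ⟨e, heU, hfV⟩)) ?_
  rw [compl_empty_iff, eq_univ_iff_forall]
  intro z
  obtain ⟨x, rfl⟩ := hg.2.1 z
  by_cases hx : x ∈ U ∩ f ⁻¹' V
  · exact ⟨f x, fun h => disjoint_left.1 hd hx.2 h.1, congr_fun hgf x⟩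
  · exact ⟨x, hx, rfl⟩

end IrreducibleOnto

theorem CompactT2.Projective.of_retract {S E : Type u} [TopologicalSpace S] [TopologicalSpace E]
    (hS : CompactT2.Projective S) {i : E → S} {r : S → E} (hi : Continuous i)
    (hr : Continuous r) (hri : r ∘ i = id) : CompactT2.Projective E := by
  intro Y Z _ _ _ _ _ _ f p hf hp hps
  obtain ⟨h, hh, hph⟩ := hS (hf.comp hr) hp hps
  refine ⟨h ∘ i, hh.comp hi, ?_⟩
  rw [← comp_assoc, hph, comp_assoc, hri, comp_id]

theorem CompactT2.Projective.exists_irreducibleOnto {S X : Type u} [TopologicalSpace S]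
    [CompactSpace S] [T2Space S] [tX : TopologicalSpace X] [CompactSpace X] [T2Space X]
    (hS : CompactT2.Projective S) {p : S → X} (hp : Continuous p) (hps : Surjective p) :
    ∃ (E : Type u) (tE : TopologicalSpace E), CompactSpace E ∧ T2Space E ∧
      ExtremallyDisconnected E ∧ ∃ g : E → X, IrreducibleOnto tE tX g := by
  obtain ⟨E, hE, hEX, hmin⟩ := exists_compact_surjective_zorn_subset hp hps
  have hg : IrreducibleOnto (inferInstanceAs (TopologicalSpace E)) tX (E.domRestrict p) := by
    refine ⟨hp.comp continuous_subtype_val, fun x => ?_, fun A hA hne => hmin A hne hA⟩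
    obtain ⟨s, hs, rfl⟩ := hEX.ge (mem_univ x)
    exact ⟨⟨s, hs⟩, rfl⟩
  obtain ⟨r, hr, hgr⟩ := hS hp hg.1 hg.2.1
  have hri : r ∘ Subtype.val = id :=
    hg.eq_id_of_comp_eq (hr.comp continuous_subtype_val) (by rw [← comp_assoc, hgr]; rfl)
  exact ⟨E, inferInstance, hE, inferInstance,
    CompactT2.Projective.extremallyDisconnected (hS.of_retract continuous_subtype_val hr hri),
    _, hg⟩

theorem exists_irreducibleOnto_of_discrete {D X : Type u} [TopologicalSpace D]
    [DiscreteTopology D] [tX : TopologicalSpace X] [CompactSpace X] [T2Space X] {f : D → X}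
    (hf : Surjective f) :
    ∃ (E : Type u) (tE : TopologicalSpace E), CompactSpace E ∧ T2Space E ∧
      ExtremallyDisconnected E ∧ ∃ g : E → X, IrreducibleOnto tE tX g := by
  have hc : Continuous f := continuous_of_discreteTopology
  refine CompactT2.Projective.exists_irreducibleOnto StoneCech.projective
    (continuous_stoneCechExtend hc) fun x => ?_
  obtain ⟨d, rfl⟩ := hf x
  exact ⟨stoneCechUnit d, congr_fun (stoneCechExtend_extends hc) d⟩

/-- Every compact Hausdorff space has an absolute. -/
theorem exists_extremallyDisconnected_irreducibleOnto (X : Type u) [tX : TopologicalSpace X]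
    [CompactSpace X] [T2Space X] :
    ∃ (E : Type u) (tE : TopologicalSpace E), CompactSpace E ∧ T2Space E ∧
      ExtremallyDisconnected E ∧ ∃ g : E → X, IrreducibleOnto tE tX g :=
  @exists_irreducibleOnto_of_discrete X X ⊥ (discreteTopology_bot X) tX _ _ id surjective_id

theorem IsPiBase.closure {E : Type*} [TopologicalSpace E] [RegularSpace E]
    [ExtremallyDisconnected E] {B : Set (Set E)} (hB : IsPiBase B) :
    IsPiBase (closure '' B) := by
  refine ⟨?_, fun V hV hne => ?_⟩
  · rintro _ ⟨U, hU, rfl⟩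
    exact ExtremallyDisconnected.open_closure U (hB.1 U hU)
  · obtain ⟨x, hx⟩ := nonempty_iff_ne_empty.2 hne
    obtain ⟨W, hxW, hW, hWV⟩ := exists_mem_nhds_isClosed_subset (hV.mem_nhds hx)
    obtain ⟨U, hU, hUne, hUW⟩ := hB.2 (interior W) isOpen_interior
      (nonempty_iff_ne_empty.1 ⟨x, mem_interior_iff_mem_nhds.2 hxW⟩)
    exact ⟨_, ⟨U, hU, rfl⟩, by simpa using hUne,
      (closure_minimal (hUW.trans interior_subset) hW).trans hWV⟩

/-- A compact space with a countable π-base of clopen sets maps irreducibly onto a compact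
metrizable space. -/
theorem IsPiBase.exists_metrizable_irreducibleOnto {E : Type u} [tE : TopologicalSpace E]
    [CompactSpace E] {B : Set (Set E)} (hB : IsPiBase B) (hc : B.Countable)
    (hclosed : ∀ U ∈ B, IsClosed U) :
    ∃ (Y : Type u) (tY : TopologicalSpace Y), CompactSpace Y ∧
      TopologicalSpace.MetrizableSpace Y ∧ ∃ h : E → Y, IrreducibleOnto tE tY h := by
  classical
  have : Countable B := hc.to_subtype
  let h : E → B → Bool := fun e U => decide (e ∈ U.1)
  have hcont : Continuous h := continuous_pi fun U => by
    have hU : IsClopen (U : Set E) := ⟨hclosed U U.2, hB.1 U U.2⟩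
    refine (continuous_bool_rng true).2 ?_
    have : (fun e => h e U) ⁻¹' {true} = U := by ext; simp [h]
    exact this ▸ hU
  refine ⟨range h, inferInstance, isCompact_iff_compactSpace.1 (isCompact_range hcont),
    TopologicalSpace.metrizableSpace_of_t3_secondCountable _, rangeFactorization h,
    hcont.subtype_mk _, rangeFactorization_surjective, fun A hA hne himg => ?_⟩
  obtain ⟨U, hU, hUne, hUA⟩ := hB.2 Aᶜ hA.isOpen_compl (by simpa [compl_empty_iff] using hne)
  obtain ⟨e, he⟩ := nonempty_iff_ne_empty.2 hUne
  obtain ⟨a, ha, hae⟩ := himg.ge (mem_univ (rangeFactorization h e))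
  have hae' := congr_fun (congr_arg Subtype.val hae) ⟨U, hU⟩
  have : a ∈ U := by simpa [h, rangeFactorization, he] using hae'
  exact hUA this ha

/-- (Ponomarev) A compact Hausdorff space is co-absolute with a compact metrizable space
iff its π-weight is at most `ℵ₀`. -/
theorem stmt17 {X : Type u} [tX : TopologicalSpace X] [CompactSpace X] [T2Space X] :
    (∃ (Y : Type u) (tY : TopologicalSpace Y),
      @CompactSpace Y tY ∧ @TopologicalSpace.MetrizableSpace Y tY ∧
      CoAbsolute X Y tX tY) ↔
    piWeight X ≤ Cardinal.aleph0 := by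
  constructor
  · rintro ⟨Y, tY, hYc, hYm, E, tE, hEc, hE2, -, ⟨g, hg⟩, h, hh⟩
    have : SecondCountableTopology Y := by
      let := TopologicalSpace.metrizableSpaceMetric Y
      infer_instance
    have hB := (TopologicalSpace.isBasis_countableBasis Y).isPiBase
    exact piWeight_le_aleph0_iff.2 ⟨_, hg.isPiBase_image_compl_compl (hh.isPiBase_preimage hB),
      ((TopologicalSpace.countable_countableBasis Y).image _).image _⟩
  · intro hX
    obtain ⟨B, hB, hBc⟩ := piWeight_le_aleph0_iff.1 hX
    obtain ⟨E, tE, hEc, hE2, hED, g, hg⟩ := exists_extremallyDisconnected_irreducibleOnto X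
    obtain ⟨Y, tY, hYc, hYm, h, hh⟩ :=
      (hg.isPiBase_preimage hB).closure.exists_metrizable_irreducibleOnto
        ((hBc.image _).image _) (by rintro _ ⟨U, -, rfl⟩; exact isClosed_closure)
    exact ⟨Y, tY, hYc, hYm, E, tE, hEc, hE2, hED, ⟨g, hg⟩, h, hh⟩
end

section
/- Let A be a Boolean algebra and τ an infinite cardinal. The following are equivalent: (a) A is isomorphic (order-isomorphic) to the poset RO(X) of regular open subsets of some semiregular space X with w(X) = τ; (b) A is a complete Boolean algebra containing a dense subset B with |B| = τ; (c) A is isomorphic (order-isomorphic) to the poset RC(Y) of regular closed subsets of some compact Hausdorff zero-dimensional space Y with w(Y) = τ. -/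
universe u

/-- The poset of regular closed subsets of `X`, ordered by inclusion. -/
abbrev RC (X : Type*) [TopologicalSpace X] := {F : Set X // F = closure (interior F)}

/-- The poset of regular open subsets of `X`, ordered by inclusion. -/
abbrev RO (X : Type*) [TopologicalSpace X] := {U : Set X // U = interior (closure U)}

/-- The weight of a topological space: the minimum cardinality of a base of open sets. -/
noncomputable def tweight (X : Type*) [TopologicalSpace X] : Cardinal :=
  ⨅ B : {B : Set (Set X) // TopologicalSpace.IsTopologicalBasis B}, Cardinal.mk ↥B.1

open TopologicalSpace Set

section Weight

variable (X : Type u) [TopologicalSpace X]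

theorem exists_basis_mk_eq_tweight :
    ∃ B : Set (Set X), IsTopologicalBasis B ∧ Cardinal.mk ↥B = tweight X := by
  have : Nonempty {B : Set (Set X) // IsTopologicalBasis B} := ⟨⟨_, isTopologicalBasis_opens⟩⟩
  obtain ⟨B, hB⟩ := ciInf_mem
    (fun B : {B : Set (Set X) // IsTopologicalBasis B} => Cardinal.mk ↥B.1)
  exact ⟨B.1, B.2, hB⟩

variable {X}

theorem tweight_le_mk {B : Set (Set X)} (hB : IsTopologicalBasis B) :
    tweight X ≤ Cardinal.mk ↥B :=
  ciInf_le' (fun B : {B : Set (Set X) // IsTopologicalBasis B} => Cardinal.mk ↥B.1) ⟨B, hB⟩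

end Weight

section RegularSets

variable {X : Type u} [TopologicalSpace X]

theorem closure_eq_closure_interior {U : Set X} (hU : IsOpen U) :
    closure U = closure (interior (closure U)) :=
  (closure_mono hU.subset_interior_closure).antisymm
    (closure_minimal interior_subset isClosed_closure)

/-- Taking interiors identifies regular closed sets with regular open sets. -/
def rcOrderIsoRo : RC X ≃o RO X where
  toFun F := ⟨interior F.1, congrArg interior F.2⟩
  invFun U := ⟨closure U.1, congrArg closure U.2⟩
  left_inv F := Subtype.ext F.2.symm
  right_inv U := Subtype.ext U.2.symm
  map_rel_iff' := by
    intro F G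
    refine ⟨fun h => ?_, fun h => interior_mono h⟩
    have : closure (interior F.1) ⊆ closure (interior G.1) := closure_mono h
    rwa [← F.2, ← G.2] at this

theorem RO.exists_isLUB (S : Set (RO X)) : ∃ s, IsLUB S s := by
  refine ⟨⟨interior (closure (⋃ U ∈ S, U.1)), interior_closure_idem.symm⟩, fun U hU => ?_,
    fun V hV => ?_⟩
  · change U.1 ⊆ _
    rw [U.2]
    exact interior_mono (closure_mono (subset_biUnion_of_mem (u := fun U : RO X => U.1) hU))
  · change _ ⊆ V.1
    rw [V.2]
    exact interior_mono (closure_mono (iUnion₂_subset fun U hU => hV hU))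

theorem RO.exists_dense_mk_eq_tweight
    (hX : IsTopologicalBasis {U : Set X | U = interior (closure U)})
    (hw : Cardinal.aleph0 ≤ tweight X) :
    ∃ D : Set (RO X), (∀ U : RO X, U.1.Nonempty → ∃ V ∈ D, V.1.Nonempty ∧ V ≤ U) ∧
      Cardinal.mk ↥D = tweight X := by
  obtain ⟨B, hB, hBw⟩ := exists_basis_mk_eq_tweight X
  obtain ⟨S, hS⟩ := Cardinal.le_mk_iff_exists_set.1 (tweight_le_mk hX)
  let r : Set X → RO X := fun U => ⟨interior (closure U), interior_closure_idem.symm⟩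
  refine ⟨r '' B ∪ S, fun U ⟨x, hx⟩ => ?_, le_antisymm ?_ ?_⟩
  · have hUo : IsOpen U.1 := by rw [U.2]; exact isOpen_interior
    obtain ⟨V, hV, hxV, hVU⟩ := hB.exists_subset_of_mem_open hx hUo
    refine ⟨r V, Or.inl ⟨V, hV, rfl⟩,
      ⟨x, (hB.isOpen hV).subset_interior_closure hxV⟩, ?_⟩
    change _ ⊆ U.1
    rw [U.2]
    exact interior_mono (closure_mono hVU)
  · refine (Cardinal.mk_union_le _ _).trans (Cardinal.add_le_of_le hw ?_ hS.le)
    exact Cardinal.mk_image_le.trans hBw.le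
  · exact hS.symm.le.trans (Cardinal.mk_le_mk_of_subset subset_union_right)

end RegularSets

section Generation

variable {A : Type u} [BooleanAlgebra A]

/-- One round of adjoining complements and binary joins. -/
def booleanStep (S : Set A) : Set A := S ∪ compl '' S ∪ image2 (· ⊔ ·) S S

theorem subset_booleanStep (S : Set A) : S ⊆ booleanStep S :=
  fun _ h => Or.inl (Or.inl h)

theorem mk_booleanStep_le {τ : Cardinal.{u}} (hτ : Cardinal.aleph0 ≤ τ) {S : Set A}
    (hS : Cardinal.mk ↥S ≤ τ) : Cardinal.mk ↥(booleanStep S) ≤ τ := by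
  refine (Cardinal.mk_union_le _ _).trans (Cardinal.add_le_of_le hτ
    ((Cardinal.mk_union_le _ _).trans (Cardinal.add_le_of_le hτ hS
      (Cardinal.mk_image_le.trans hS))) ?_)
  exact Cardinal.mk_image2_le.trans (Cardinal.mul_le_of_le hτ hS hS)

theorem exists_booleanSubalgebra_mk_eq {τ : Cardinal.{u}} (hτ : Cardinal.aleph0 ≤ τ) {B : Set A}
    (hB : Cardinal.mk ↥B = τ) :
    ∃ C : BooleanSubalgebra A, B ⊆ C ∧ Cardinal.mk C = τ := by
  let S : ℕ → Set A := fun n => booleanStep^[n] (insert ⊥ B)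
  have hS : ∀ n, S (n + 1) = booleanStep (S n) := fun n => Function.iterate_succ_apply' _ _ _
  have hmono : Monotone S := monotone_nat_of_le_succ fun n => by
    rw [hS]; exact subset_booleanStep _
  have hcard : ∀ n, Cardinal.mk ↥(S n) ≤ τ := by
    intro n
    induction n with
    | zero =>
      exact Cardinal.mk_insert_le.trans
        (Cardinal.add_le_of_le hτ hB.le (Cardinal.one_le_aleph0.trans hτ))
    | succ n ih => rw [hS]; exact mk_booleanStep_le hτ ih
  have hcompl : ∀ {a}, a ∈ ⋃ n, S n → aᶜ ∈ ⋃ n, S n := by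
    intro a ha
    obtain ⟨n, hn⟩ := mem_iUnion.1 ha
    refine mem_iUnion.2 ⟨n + 1, ?_⟩
    rw [hS]
    exact Or.inl (Or.inr ⟨a, hn, rfl⟩)
  have hsup : ∀ {a b}, a ∈ ⋃ n, S n → b ∈ ⋃ n, S n → a ⊔ b ∈ ⋃ n, S n := by
    intro a b ha hb
    obtain ⟨n, hn⟩ := mem_iUnion.1 ha
    obtain ⟨m, hm⟩ := mem_iUnion.1 hb
    refine mem_iUnion.2 ⟨max n m + 1, ?_⟩
    rw [hS]
    exact Or.inr ⟨a, hmono (le_max_left _ _) hn, b, hmono (le_max_right _ _) hm, rfl⟩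
  have hBS : B ⊆ ⋃ n, S n := fun b hb => mem_iUnion.2 ⟨0, mem_insert_of_mem _ hb⟩
  refine ⟨{ carrier := ⋃ n, S n
            supClosed' := fun a ha b hb => hsup ha hb
            infClosed' := fun a ha b hb => by
              simpa using hcompl (hsup (hcompl ha) (hcompl hb))
            compl_mem' := hcompl
            bot_mem' := mem_iUnion.2 ⟨0, mem_insert _ _⟩ }, hBS, le_antisymm ?_ ?_⟩
  · change Cardinal.mk ↥(⋃ n, S n) ≤ τ
    have h := Cardinal.mk_iUnion_le_lift S
    rw [Cardinal.lift_id'] at h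
    refine h.trans ?_
    refine Cardinal.mul_le_of_le hτ (by simpa using hτ) ?_
    exact ciSup_le' fun n => by simpa using hcard n
  · exact hB.symm.le.trans (Cardinal.mk_le_mk_of_subset hBS)

end Generation

section Stone

variable (C : Type u) [BooleanAlgebra C]

/-- The Stone space of a Boolean algebra: its two-valued homomorphisms, with the topology of
pointwise convergence. -/
abbrev StoneSpec : Type u :=
  {f : C → Bool // (∀ a b, f (a ⊓ b) = (f a && f b)) ∧ ∀ a, f aᶜ = !f a}

instance : CompactSpace (StoneSpec C) := by
  refine isCompact_iff_compactSpace.1 (IsClosed.isCompact ?_)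
  refine IsClosed.inter (s₁ := {f : C → Bool | ∀ a b, f (a ⊓ b) = (f a && f b)})
    (s₂ := {f : C → Bool | ∀ a, f aᶜ = !f a}) ?_ ?_
  · simp only [ofPred_forall]
    refine isClosed_iInter fun a => isClosed_iInter fun b => isClosed_eq (by fun_prop) ?_
    have hand : Continuous fun p : Bool × Bool => p.1 && p.2 := continuous_of_discreteTopology
    have hpair : Continuous fun f : C → Bool => (f a, f b) := by fun_prop
    exact hand.comp hpair
  · simp only [ofPred_forall]
    refine isClosed_iInter fun a => isClosed_eq (by fun_prop) ?_
    exact (continuous_of_discreteTopology (f := Bool.not)).comp (continuous_apply a)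

variable {C}

/-- The basic clopen set of the Stone space given by an element of the algebra. -/
def stoneSet (a : C) : Set (StoneSpec C) := {f | f.1 a = true}

theorem mem_stoneSet {a : C} {f : StoneSpec C} : f ∈ stoneSet a ↔ f.1 a = true := Iff.rfl

theorem stoneSet_inf (a b : C) : stoneSet (a ⊓ b) = stoneSet a ∩ stoneSet b := by
  ext f
  simp [mem_stoneSet, f.2.1]

theorem stoneSet_compl (a : C) : stoneSet aᶜ = (stoneSet a)ᶜ := by
  ext f
  simp [mem_stoneSet, f.2.2]

theorem stoneSet_bot : stoneSet (⊥ : C) = ∅ := by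
  rw [← inf_compl_self (⊤ : C), stoneSet_inf, stoneSet_compl, inter_compl_self]

theorem stoneSet_top : stoneSet (⊤ : C) = univ := by
  rw [← compl_bot, stoneSet_compl, stoneSet_bot, compl_empty]

theorem isClopen_stoneSet (a : C) : IsClopen (stoneSet a) :=
  (isClopen_discrete {true}).preimage
    ((continuous_apply a).comp continuous_subtype_val : Continuous fun f : StoneSpec C => f.1 a)

theorem stoneSet_nonempty {a : C} (ha : a ≠ ⊥) : (stoneSet a).Nonempty := by
  classical
  obtain ⟨J, hJ, -, haJ⟩ := DistribLattice.prime_ideal_of_disjoint_filter_ideal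
    (F := Order.PFilter.principal a) (I := Order.Ideal.principal ⊥) (by
      rw [disjoint_left]
      intro x hx hx'
      have h₁ : a ≤ x := hx
      have h₂ : x ≤ ⊥ := hx'
      exact ha (le_bot_iff.1 (h₁.trans h₂)))
  have hcompl : ∀ x, xᶜ ∈ J ↔ x ∉ J := by
    refine fun x => ⟨fun h h' => hJ.toIsProper.top_notMem ?_, fun h => hJ.compl_mem_of_notMem h⟩
    rw [← sup_compl_eq_top (x := x)]
    exact Order.Ideal.sup_mem h' h
  refine ⟨⟨fun x => decide (x ∉ J), fun x y => ?_, fun x => ?_⟩, ?_⟩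
  · have : x ⊓ y ∈ J ↔ x ∈ J ∨ y ∈ J :=
      ⟨hJ.mem_or_mem, fun h => h.elim (J.lower inf_le_left) (J.lower inf_le_right)⟩
    simp [this]
  · simp [hcompl]
  · have : a ∉ J := disjoint_left.1 haJ (show a ≤ a from le_rfl)
    simpa [mem_stoneSet] using this

theorem stoneSet_subset_iff {a b : C} : stoneSet a ⊆ stoneSet b ↔ a ≤ b := by
  refine ⟨fun h => ?_, fun h => ?_⟩
  · by_contra hab
    have hne : a ⊓ bᶜ ≠ ⊥ := fun h0 => hab (by
      rwa [← disjoint_iff, disjoint_compl_right_iff] at h0)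
    obtain ⟨f, hf⟩ := stoneSet_nonempty hne
    rw [stoneSet_inf, stoneSet_compl] at hf
    exact hf.2 (h hf.1)
  · rw [← inf_eq_left.2 h, stoneSet_inf]
    exact inter_subset_right

theorem stoneSet_injective : Function.Injective (stoneSet (C := C)) := fun _ _ h =>
  (stoneSet_subset_iff.1 h.subset).antisymm (stoneSet_subset_iff.1 h.superset)

theorem stoneSet_finset_inf {ι : Type*} (s : Finset ι) (g : ι → C) :
    stoneSet (s.inf g) = ⋂ i ∈ s, stoneSet (g i) := by
  classical
  induction s using Finset.induction_on with
  | empty => simp [stoneSet_top]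
  | insert i s _ ih => rw [Finset.inf_insert, stoneSet_inf, ih, Finset.set_biInter_insert]

theorem isTopologicalBasis_range_stoneSet :
    IsTopologicalBasis (range (stoneSet (C := C))) := by
  refine isTopologicalBasis_of_isOpen_of_nhds ?_ ?_
  · rintro _ ⟨a, rfl⟩
    exact (isClopen_stoneSet a).isOpen
  · intro f U hf hU
    obtain ⟨V, hV, rfl⟩ := isOpen_induced_iff.1 hU
    obtain ⟨I, u, hu, huV⟩ := isOpen_pi_iff.1 hV f.1 hf
    refine ⟨_, ⟨I.inf fun i => if f.1 i = true then i else iᶜ, rfl⟩, ?_, ?_⟩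
    · rw [stoneSet_finset_inf]
      refine mem_iInter₂.2 fun i _ => ?_
      by_cases h : f.1 i = true <;> simp [h, mem_stoneSet, f.2.2]
    · intro g hg
      rw [stoneSet_finset_inf] at hg
      refine huV fun i hi => ?_
      have hgi := mem_iInter₂.1 hg i hi
      have : g.1 i = f.1 i := by
        by_cases h : f.1 i = true
        · simpa [h, mem_stoneSet] using hgi
        · simpa [h, mem_stoneSet, g.2.2] using hgi
      rw [this]
      exact (hu i hi).2

theorem isTopologicalBasis_isClopen_stoneSpec :
    IsTopologicalBasis {s : Set (StoneSpec C) | IsClopen s} :=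
  isTopologicalBasis_range_stoneSet.of_isOpen_of_subset (fun _ h => h.isOpen) (by
    rintro _ ⟨a, rfl⟩
    exact isClopen_stoneSet a)

theorem tweight_stoneSpec (hC : Cardinal.aleph0 ≤ Cardinal.mk C) :
    tweight (StoneSpec C) = Cardinal.mk C := by
  refine le_antisymm
    ((tweight_le_mk isTopologicalBasis_range_stoneSet).trans Cardinal.mk_range_le) ?_
  obtain ⟨B, hB, hBw⟩ := exists_basis_mk_eq_tweight (StoneSpec C)
  rw [← hBw]
  have hfin : ∀ a : C, ∃ s : Finset B, stoneSet a = ⋃ U ∈ s, U.1 := by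
    intro a
    obtain ⟨s, hs⟩ := eq_sUnion_finset_of_isTopologicalBasis_of_isCompact_open B hB (stoneSet a)
      (isClopen_stoneSet a).isClosed.isCompact (isClopen_stoneSet a).isOpen
    refine ⟨s, ?_⟩
    rw [hs]
    ext x
    simp
  choose s hs using hfin
  have hinj : Function.Injective s := fun a b h => stoneSet_injective (by rw [hs a, hs b, h])
  have hle := Cardinal.mk_le_of_injective hinj
  have : Infinite B := by
    by_contra hfinB
    have := not_infinite_iff_finite.1 hfinB
    exact (Cardinal.aleph0_le_mk_iff.1 (hC.trans hle)).not_finite inferInstance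
  rwa [Cardinal.mk_finset_of_infinite] at hle

end Stone

section Completion

variable {A : Type u} [BooleanAlgebra A] (C : BooleanSubalgebra A)

/-- The open set of the Stone space of a subalgebra given by an element of the whole algebra. -/
def lowerOpen (a : A) : Set (StoneSpec C) := ⋃ c : {c : C // (c : A) ≤ a}, stoneSet c.1

variable {C}

theorem mem_lowerOpen {a : A} {f : StoneSpec C} :
    f ∈ lowerOpen C a ↔ ∃ c : C, (c : A) ≤ a ∧ f ∈ stoneSet c := by
  simp [lowerOpen]

theorem isOpen_lowerOpen (a : A) : IsOpen (lowerOpen C a) :=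
  isOpen_iUnion fun c => (isClopen_stoneSet c.1).isOpen

theorem lowerOpen_mono {a b : A} (h : a ≤ b) : lowerOpen C a ⊆ lowerOpen C b := fun f hf => by
  obtain ⟨c, hc, hfc⟩ := mem_lowerOpen.1 hf
  exact mem_lowerOpen.2 ⟨c, hc.trans h, hfc⟩

theorem closure_lowerOpen_subset_iff (hC : ∀ a : A, a ≠ ⊥ → ∃ c : C, c ≠ ⊥ ∧ (c : A) ≤ a)
    {a b : A} : closure (lowerOpen C a) ⊆ closure (lowerOpen C b) ↔ a ≤ b := by
  refine ⟨fun h => ?_, fun h => closure_mono (lowerOpen_mono h)⟩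
  by_contra hab
  have hne : a ⊓ bᶜ ≠ ⊥ := fun h0 => hab (by
    rwa [← disjoint_iff, disjoint_compl_right_iff] at h0)
  obtain ⟨c, hc, hcab⟩ := hC _ hne
  obtain ⟨f, hf⟩ := stoneSet_nonempty hc
  obtain ⟨g, hgc, hgb⟩ := mem_closure_iff.1
    (h (subset_closure (mem_lowerOpen.2 ⟨c, hcab.trans inf_le_left, hf⟩))) _
    (isClopen_stoneSet c).isOpen hf
  obtain ⟨d, hd, hgd⟩ := mem_lowerOpen.1 hgb
  have hcd : c ⊓ d = ⊥ := by
    refine Subtype.ext (le_bot_iff.1 ?_)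
    exact (inf_le_inf (hcab.trans inf_le_right) hd).trans (compl_inf_eq_bot (a := b)).le
  have : g ∈ stoneSet (c ⊓ d) := by rw [stoneSet_inf]; exact ⟨hgc, hgd⟩
  rw [hcd, stoneSet_bot] at this
  exact this

theorem closure_lowerOpen_eq_closure {U : Set (StoneSpec C)} (hU : IsOpen U) {a : A}
    (ha : IsLUB {x : A | ∃ c : C, (c : A) = x ∧ stoneSet c ⊆ U} a) :
    closure (lowerOpen C a) = closure U := by
  refine (closure_minimal (fun f hf => ?_) isClosed_closure).antisymm
    (closure_mono fun f hf => ?_)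
  · obtain ⟨c, hca, hfc⟩ := mem_lowerOpen.1 hf
    refine isTopologicalBasis_range_stoneSet.mem_closure_iff.2 ?_
    rintro _ ⟨d, rfl⟩ hfd
    by_contra hemp
    have hle : a ≤ ((c ⊓ d : C) : A)ᶜ := by
      refine ha.2 ?_
      rintro _ ⟨e, rfl, heU⟩
      have : e ≤ (c ⊓ d)ᶜ := by
        rw [← stoneSet_subset_iff, stoneSet_compl, stoneSet_inf]
        exact fun g hg hg' => hemp ⟨g, hg'.2, heU hg⟩
      exact this
    have h0 : c ⊓ d = ⊥ := by
      have h₁ : ((c ⊓ d : C) : A) ≤ ((c ⊓ d : C) : A)ᶜ :=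
        (show ((c ⊓ d : C) : A) ≤ c from inf_le_left).trans (hca.trans hle)
      exact Subtype.ext (le_compl_self.1 h₁)
    have : f ∈ stoneSet (c ⊓ d) := by rw [stoneSet_inf]; exact ⟨hfc, hfd⟩
    rw [h0, stoneSet_bot] at this
    exact this
  · obtain ⟨_, ⟨c, rfl⟩, hfc, hcU⟩ :=
      isTopologicalBasis_range_stoneSet.exists_subset_of_mem_open hf hU
    exact mem_lowerOpen.2 ⟨c, ha.1 ⟨c, rfl, hcU⟩, hfc⟩

/-- A complete Boolean algebra with a dense subalgebra is the algebra of regular closed sets of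
the Stone space of that subalgebra. -/
theorem nonempty_orderIso_RC_stoneSpec (hA : ∀ S : Set A, ∃ s : A, IsLUB S s)
    (hC : ∀ a : A, a ≠ ⊥ → ∃ c : C, c ≠ ⊥ ∧ (c : A) ≤ a) :
    Nonempty (A ≃o RC (StoneSpec C)) := by
  let φ : A ↪o RC (StoneSpec C) := OrderEmbedding.ofMapLEIff
    (fun a => ⟨closure (lowerOpen C a), by
      conv_lhs => rw [closure_eq_closure_interior (isOpen_lowerOpen a)]⟩)
    (fun a b => closure_lowerOpen_subset_iff hC)
  refine ⟨RelIso.ofSurjective φ fun F => ?_⟩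
  obtain ⟨a, ha⟩ := hA {x : A | ∃ c : C, (c : A) = x ∧ stoneSet c ⊆ interior F.1}
  exact ⟨a, Subtype.ext ((closure_lowerOpen_eq_closure isOpen_interior ha).trans F.2.symm)⟩

end Completion

section Transfer

variable {A : Type u} [BooleanAlgebra A] {X : Type u} [TopologicalSpace X]

theorem complete_and_dense_of_orderIso_RO (e : A ≃o RO X)
    (hX : IsTopologicalBasis {U : Set X | U = interior (closure U)})
    (hw : Cardinal.aleph0 ≤ tweight X) :
    (∀ S : Set A, ∃ s : A, IsLUB S s) ∧
      ∃ B : Set A, (∀ a : A, a ≠ ⊥ → ∃ b ∈ B, b ≠ ⊥ ∧ b ≤ a) ∧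
        Cardinal.mk ↥B = tweight X := by
  have hbot : ∀ U : RO X, U.1.Nonempty ↔ e.symm U ≠ ⊥ := by
    have he : (e ⊥).1 = ∅ := by
      have : e ⊥ ≤ ⟨∅, by simp⟩ := by
        rw [← e.le_symm_apply]
        exact bot_le
      exact subset_empty_iff.1 this
    intro U
    rw [nonempty_iff_ne_empty, ne_eq, ne_eq, e.symm_apply_eq, Subtype.ext_iff, he]
  refine ⟨fun S => ?_, ?_⟩
  · obtain ⟨s, hs⟩ := RO.exists_isLUB (e '' S)
    exact ⟨e.symm s, e.isLUB_image.1 hs⟩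
  · obtain ⟨D, hD, hDw⟩ := RO.exists_dense_mk_eq_tweight hX hw
    refine ⟨e.symm '' D, fun a ha => ?_, (Cardinal.mk_image_eq e.symm.injective).trans hDw⟩
    obtain ⟨V, hV, hVn, hVle⟩ := hD (e a) ((hbot _).2 (by simpa using ha))
    exact ⟨e.symm V, ⟨V, hV, rfl⟩, (hbot V).1 hVn, e.symm_apply_le.2 hVle⟩

theorem isTopologicalBasis_regularOpen_of_isClopen
    (hX : IsTopologicalBasis {s : Set X | IsClopen s}) :
    IsTopologicalBasis {U : Set X | U = interior (closure U)} :=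
  hX.of_isOpen_of_subset (fun U (hU : U = _) => by rw [hU]; exact isOpen_interior)
    fun U (hU : IsClopen U) => by
      rw [mem_ofPred_eq, hU.isClosed.closure_eq, hU.isOpen.interior_eq]

end Transfer

/-- For an infinite cardinal `τ` and a Boolean algebra `A`, the following are equivalent:
(a) `A ≅ RO(X)` for some semiregular space `X` of weight `τ`;
(b) `A` is complete and has a dense subset of cardinality `τ`;
(c) `A ≅ RC(Y)` for some compact Hausdorff zero-dimensional space `Y` of weight `τ`. -/
theorem stmt19 {A : Type u} [BooleanAlgebra A] (τ : Cardinal.{u})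
    (hτ : Cardinal.aleph0 ≤ τ) :
    ((∃ (X : Type u) (tX : TopologicalSpace X),
        @TopologicalSpace.IsTopologicalBasis X tX
          {U : Set X | U = @interior X tX (@closure X tX U)} ∧
        @tweight X tX = τ ∧ Nonempty (A ≃o @RO X tX)) ↔
      ((∀ S : Set A, ∃ s : A, IsLUB S s) ∧
        ∃ B : Set A, (∀ a : A, a ≠ ⊥ → ∃ b ∈ B, b ≠ ⊥ ∧ b ≤ a) ∧ Cardinal.mk ↥B = τ)) ∧
    (((∀ S : Set A, ∃ s : A, IsLUB S s) ∧
        ∃ B : Set A, (∀ a : A, a ≠ ⊥ → ∃ b ∈ B, b ≠ ⊥ ∧ b ≤ a) ∧ Cardinal.mk ↥B = τ) ↔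
      (∃ (Y : Type u) (tY : TopologicalSpace Y),
        @CompactSpace Y tY ∧ @T2Space Y tY ∧
        @TopologicalSpace.IsTopologicalBasis Y tY {s : Set Y | @IsClopen Y tY s} ∧
        @tweight Y tY = τ ∧ Nonempty (A ≃o @RC Y tY))) := by
  have hab : ∀ (X : Type u) (tX : TopologicalSpace X),
      IsTopologicalBasis {U : Set X | U = interior (closure U)} → tweight X = τ →
      Nonempty (A ≃o RO X) → ((∀ S : Set A, ∃ s : A, IsLUB S s) ∧
        ∃ B : Set A, (∀ a : A, a ≠ ⊥ → ∃ b ∈ B, b ≠ ⊥ ∧ b ≤ a) ∧ Cardinal.mk ↥B = τ) := by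
    rintro X tX hX rfl ⟨e⟩
    exact complete_and_dense_of_orderIso_RO e hX hτ
  have hbc : ((∀ S : Set A, ∃ s : A, IsLUB S s) ∧
      ∃ B : Set A, (∀ a : A, a ≠ ⊥ → ∃ b ∈ B, b ≠ ⊥ ∧ b ≤ a) ∧ Cardinal.mk ↥B = τ) →
      ∃ C : BooleanSubalgebra A, tweight (StoneSpec C) = τ ∧
        Nonempty (A ≃o RC (StoneSpec C)) := by
    rintro ⟨hA, B, hB, hBτ⟩
    obtain ⟨C, hBC, hCτ⟩ := exists_booleanSubalgebra_mk_eq hτ hBτ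
    refine ⟨C, (tweight_stoneSpec (hCτ.symm ▸ hτ)).trans hCτ,
      nonempty_orderIso_RC_stoneSpec hA fun a ha => ?_⟩
    obtain ⟨b, hb, hb0, hba⟩ := hB a ha
    exact ⟨⟨b, hBC hb⟩, fun h => hb0 (congrArg Subtype.val h), hba⟩
  refine ⟨⟨fun ⟨X, tX, hX, hw, he⟩ => hab X tX hX hw he, fun h => ?_⟩, fun h => ?_, ?_⟩
  · obtain ⟨C, hw, ⟨e⟩⟩ := hbc h
    exact ⟨StoneSpec C, inferInstance,
      isTopologicalBasis_regularOpen_of_isClopen isTopologicalBasis_isClopen_stoneSpec, hw,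
      ⟨e.trans rcOrderIsoRo⟩⟩
  · obtain ⟨C, hw, he⟩ := hbc h
    exact ⟨StoneSpec C, inferInstance, inferInstance, inferInstance,
      isTopologicalBasis_isClopen_stoneSpec, hw, he⟩
  · rintro ⟨Y, tY, -, -, hY, hw, ⟨e⟩⟩
    exact hab Y tY (isTopologicalBasis_regularOpen_of_isClopen hY) hw ⟨e.trans rcOrderIsoRo⟩
end
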